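/- Let θ : ℝ² → ℝ be a Y-periodic function of class C², where Y = [0,1]², and let Θ^h(x₁,x₂,x₃^h) = (x₁,x₂,h²θ(x₁/h,x₂/h)) + x₃^h n^h(x₁,x₂), where n^h is the unit normal to the surface (x₁,x₂) ↦ (x₁,x₂,h²θ(x₁/h,x₂/h)). Then there exists h₀ = h₀(θ) > 0 such that the Jacobian matrix ∇Θ^h(x^h) is invertible for all x^h ∈ Ω̄^h = ω̄ × [−h²/2, h²/2] and all h ≤ h₀, and there exists C₀ > 0 such that for all h ≤ h₀: det ∇Θ^h = 1 + h²δ^h(x^h); ∇Θ^h(x^h) = I − hC(x₁,x₂) − h²D(x₁,x₂,x₃) + h³R₁^h(x^h); (∇Θ^h(x^h))⁻¹ = I + hC(x₁,x₂) + h²E(x₁,x₂,x₃) + h³R₂^h(x^h); and ‖∇Θ^h − I‖_{L^∞}, ‖(∇Θ^h)⁻¹ − I‖_{L^∞} ≤ Ch. Here C is the skew-symmetric matrix with entries C₁₃ = ∂₁θ(x₁/h,x₂/h), C₂₃ = ∂₂θ(x₁/h,x₂/h) (and zero elsewhere up to antisymmetry), D is the symmetric matrix with upper-left 2×2 block x₃∇²θ(x₁/h,x₂/h)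 and (3,3)-entry (1/2)(|∂₁θ|² + |∂₂θ|²)(x₁/h,x₂/h), E = C² + D, and the remainders satisfy sup_{0<h≤h₀} max_{x^h∈Ω̄^h} |δ^h(x^h)| ≤ C₀ and sup_{0<h≤h₀} max_{i,j} max_{x^h∈Ω̄^h} |R^h_{k,ij}(x^h)| ≤ C₀ for k = 1,2. -/

import Mathlib

open MeasureTheory Filter Topology

noncomputable section

attribute [local instance] Matrix.normedAddCommGroup

abbrev E (n : ℕ) := Fin n → ℝ

/-- `f` is `[0,1]^n`-periodic. -/
def YPeriodic {α : Type*} {n : ℕ} (f : E n → α) : Prop :=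
  ∀ (y : E n) (k : Fin n → ℤ), f (y + fun i => (k i : ℝ)) = f y

/-- partial derivative `∂ᵢ f`. -/
def pd {n : ℕ} (i : Fin n) (f : E n → ℝ) (x : E n) : ℝ :=
  fderiv ℝ f x (Pi.single i 1)

/-- second partial derivative `∂ᵢ∂ⱼ f`. -/
def pd2 {n : ℕ} (i j : Fin n) (f : E n → ℝ) (x : E n) : ℝ :=
  pd i (pd j f) x

/-- The unit normal `n^h` to the mid-surface `(x₁,x₂) ↦ (x₁,x₂,h²θ(x₁/h,x₂/h))`. -/
def nh (θ : E 2 → ℝ) (h : ℝ) (x' : E 2) : E 3 :=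
  (Real.sqrt (h ^ 2 * (pd 0 θ (h⁻¹ • x')) ^ 2 + h ^ 2 * (pd 1 θ (h⁻¹ • x')) ^ 2 + 1))⁻¹ •
    ![-(h * pd 0 θ (h⁻¹ • x')), -(h * pd 1 θ (h⁻¹ • x')), 1]

/-- The map `Θ^h(x₁,x₂,x₃^h) = (x₁,x₂,h²θ(x₁/h,x₂/h)) + x₃^h n^h(x₁,x₂)`. -/
def Θh (θ : E 2 → ℝ) (h : ℝ) (x : E 3) : E 3 :=
  ![x 0, x 1, h ^ 2 * θ (h⁻¹ • ![x 0, x 1])] + x 2 • nh θ h ![x 0, x 1]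

/-- The Jacobian matrix of a map `y : ℝ³ → ℝ³`. -/
def jac3 (y : E 3 → E 3) (x : E 3) : Matrix (Fin 3) (Fin 3) ℝ :=
  Matrix.of fun i j => fderiv ℝ (fun z => y z i) x (Pi.single j 1)

/-- The matrix `C(x₁,x₂)` of (2.6). -/
def Cmat (θ : E 2 → ℝ) (h : ℝ) (x' : E 2) : Matrix (Fin 3) (Fin 3) ℝ :=
  !![0, 0, pd 0 θ (h⁻¹ • x');
     0, 0, pd 1 θ (h⁻¹ • x');
     -pd 0 θ (h⁻¹ • x'), -pd 1 θ (h⁻¹ • x'), 0]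

/-- The matrix `D(x₁,x₂,x₃)` of (2.7). -/
def Dmat (θ : E 2 → ℝ) (h : ℝ) (x' : E 2) (x3 : ℝ) : Matrix (Fin 3) (Fin 3) ℝ :=
  !![x3 * pd2 0 0 θ (h⁻¹ • x'), x3 * pd2 0 1 θ (h⁻¹ • x'), 0;
     x3 * pd2 0 1 θ (h⁻¹ • x'), x3 * pd2 1 1 θ (h⁻¹ • x'), 0;
     0, 0, (1 / 2) * ((pd 0 θ (h⁻¹ • x')) ^ 2 + (pd 1 θ (h⁻¹ • x')) ^ 2)]

/-- `E = C² + D`, cf. (2.8). -/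
def Emat (θ : E 2 → ℝ) (h : ℝ) (x' : E 2) (x3 : ℝ) : Matrix (Fin 3) (Fin 3) ℝ :=
  Cmat θ h x' * Cmat θ h x' + Dmat θ h x' x3

/-- A continuous `[0,1]²`-periodic function is bounded. -/
lemma YPeriodic.exists_bound {n : ℕ} {f : E n → ℝ} (hf : Continuous f) (hper : YPeriodic f) :
    ∃ M : ℝ, ∀ y, |f y| ≤ M := by
  obtain ⟨M, hM⟩ := (isCompact_Icc (a := (0 : E n)) (b := 1)).exists_bound_of_continuousOn
    hf.continuousOn
  refine ⟨M, fun y => ?_⟩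
  have h1 := hper y (fun i => -⌊y i⌋)
  have h2 : y + (fun i => ((-⌊y i⌋ : ℤ) : ℝ)) = fun i => Int.fract (y i) := by
    funext i
    simp only [Pi.add_apply, Int.cast_neg, Int.fract]
    ring
  rw [h2] at h1
  rw [← h1]
  exact hM _ ⟨fun i => Int.fract_nonneg _, fun i => (Int.fract_lt_one _).le⟩

lemma YPeriodic.pd {n : ℕ} {f : E n → ℝ} (hper : YPeriodic f) (i : Fin n) :
    YPeriodic (pd i f) := by
  intro y k
  have h1 : (fun z => f (z + fun i => (k i : ℝ))) = f := funext fun z => hper z k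
  unfold _root_.pd
  rw [← fderiv_comp_add_right, h1]

lemma ContDiff.pd {n : ℕ} {f : E n → ℝ} {m k : WithTop ℕ∞} (hf : ContDiff ℝ k f)
    (hmk : m + 1 ≤ k) (i : Fin n) : ContDiff ℝ m (pd i f) :=
  (hf.fderiv_right hmk).clm_apply contDiff_const

lemma pd2_comm {n : ℕ} {f : E n → ℝ} (hf : ContDiff ℝ 2 f) (i j : Fin n) (y : E n) :
    pd2 i j f y = pd2 j i f y := by
  have hd : DifferentiableAt ℝ (fderiv ℝ f) y :=
    ((hf.fderiv_right (m := 1) (by norm_num)).differentiable (by norm_num)) y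
  have key : ∀ i j : Fin n, pd2 i j f y
      = fderiv ℝ (fderiv ℝ f) y (Pi.single i 1) (Pi.single j 1) := by
    intro i j
    unfold pd2 pd
    rw [fderiv_clm_apply hd (differentiableAt_const _)]
    simp
  rw [key, key]
  exact (hf.contDiffAt.isSymmSndFDerivAt (by simp)).eq _ _

/-- The linear map `x ↦ (x₁/h, x₂/h)`. -/
def scaledProj (h : ℝ) : E 3 →L[ℝ] E 2 :=
  h⁻¹ • ContinuousLinearMap.pi ![ContinuousLinearMap.proj 0, ContinuousLinearMap.proj 1]

lemma scaledProj_apply (h : ℝ) (x : E 3) : scaledProj h x = h⁻¹ • ![x 0, x 1] := by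
  funext i
  fin_cases i <;> simp [scaledProj]

lemma scaledProj_single_zero (h : ℝ) : scaledProj h (Pi.single 0 1) = h⁻¹ • Pi.single 0 1 := by
  rw [scaledProj_apply]
  funext i
  fin_cases i <;> simp

lemma scaledProj_single_one (h : ℝ) : scaledProj h (Pi.single 1 1) = h⁻¹ • Pi.single 1 1 := by
  rw [scaledProj_apply]
  funext i
  fin_cases i <;> simp

lemma scaledProj_single_two (h : ℝ) : scaledProj h (Pi.single 2 1) = 0 := by
  rw [scaledProj_apply]
  funext i
  fin_cases i <;> simp

/-- The three components of `Θʰ`, with the reciprocal length of the normal factored out. -/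
lemma Θh_eq (θ : E 2 → ℝ) (h : ℝ) (z : E 3) :
    Θh θ h z =
      ![z 0 + z 2 * ((√(h ^ 2 * pd 0 θ (scaledProj h z) ^ 2
            + h ^ 2 * pd 1 θ (scaledProj h z) ^ 2 + 1))⁻¹ * -(h * pd 0 θ (scaledProj h z))),
        z 1 + z 2 * ((√(h ^ 2 * pd 0 θ (scaledProj h z) ^ 2
            + h ^ 2 * pd 1 θ (scaledProj h z) ^ 2 + 1))⁻¹ * -(h * pd 1 θ (scaledProj h z))),
        h ^ 2 * θ (scaledProj h z) + z 2 * (√(h ^ 2 * pd 0 θ (scaledProj h z) ^ 2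
            + h ^ 2 * pd 1 θ (scaledProj h z) ^ 2 + 1))⁻¹] := by
  funext i
  fin_cases i <;> simp [Θh, nh, scaledProj_apply]

/-- Derivative of the reciprocal length `(h²P² + h²Q² + 1)^{-1/2}`. -/
lemma HasFDerivAt.inv_sqrt_sq_add_sq {F : Type*} [NormedAddCommGroup F] [NormedSpace ℝ F]
    {P Q : F → ℝ} {P' Q' : F →L[ℝ] ℝ} {x : F} (h : ℝ)
    (hP : HasFDerivAt P P' x) (hQ : HasFDerivAt Q Q' x) :
    HasFDerivAt (fun z => (√(h ^ 2 * P z ^ 2 + h ^ 2 * Q z ^ 2 + 1))⁻¹)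
      (-(h ^ 2 * (√(h ^ 2 * P x ^ 2 + h ^ 2 * Q x ^ 2 + 1))⁻¹ ^ 3) • (P x • P' + Q x • Q')) x := by
  have hpos : 0 < h ^ 2 * P x ^ 2 + h ^ 2 * Q x ^ 2 + 1 := by positivity
  have h1 := ((((hP.pow 2).const_mul (h ^ 2)).add ((hQ.pow 2).const_mul (h ^ 2))).add_const 1).sqrt
    hpos.ne'
  have hs : √(h ^ 2 * P x ^ 2 + h ^ 2 * Q x ^ 2 + 1) ≠ 0 := (Real.sqrt_pos.2 hpos).ne'
  have h2 := (hasDerivAt_inv hs).comp_hasFDerivAt x h1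
  refine h2.congr_fderiv ?_
  ext v
  simp
  field_simp

/-- The Jacobian matrix of `Θʰ` in terms of the first and second derivatives of `θ`. -/
lemma jac3_Θh {θ : E 2 → ℝ} (hθ : ContDiff ℝ 2 θ) {h : ℝ} (hh : h ≠ 0) (x : E 3)
    {y : E 2} (hy : y = h⁻¹ • ![x 0, x 1]) {p q a b d u r w : ℝ}
    (hp : p = pd 0 θ y) (hq : q = pd 1 θ y)
    (ha : a = pd2 0 0 θ y) (hb : b = pd2 0 1 θ y) (hd : d = pd2 1 1 θ y)
    (hu : u = (√(h ^ 2 * p ^ 2 + h ^ 2 * q ^ 2 + 1))⁻¹)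
    (hr : r = p * a + q * b) (hw : w = p * b + q * d) :
    jac3 (Θh θ h) x =
      !![1 + x 2 * (-(a * u) + h ^ 2 * p * r * u ^ 3), x 2 * (-(b * u) + h ^ 2 * p * w * u ^ 3),
          -(h * p * u);
        x 2 * (-(b * u) + h ^ 2 * q * r * u ^ 3), 1 + x 2 * (-(d * u) + h ^ 2 * q * w * u ^ 3),
          -(h * q * u);
        h * p - x 2 * h * r * u ^ 3, h * q - x 2 * h * w * u ^ 3, u] := by
  have hL : HasFDerivAt (scaledProj h) (scaledProj h) x := (scaledProj h).hasFDerivAt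
  have hy' : scaledProj h x = y := by rw [scaledProj_apply, hy]
  have hθ' : HasFDerivAt (fun z => θ (scaledProj h z))
      ((fderiv ℝ θ y).comp (scaledProj h)) x := by
    rw [← hy']
    exact ((hθ.differentiable (by norm_num)) _).hasFDerivAt.comp x hL
  have hpd : ∀ i, HasFDerivAt (fun z => pd i θ (scaledProj h z))
      ((fderiv ℝ (pd i θ) y).comp (scaledProj h)) x := by
    intro i
    rw [← hy']
    exact (((hθ.pd (m := 1) (by norm_num) i).differentiable (by norm_num)) _).hasFDerivAt.comp x hL
  have hU := (hpd 0).inv_sqrt_sq_add_sq h (hpd 1)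
  have hc : ∀ i : Fin 3, HasFDerivAt (fun z : E 3 => z i)
      (ContinuousLinearMap.proj (R := ℝ) (φ := fun _ : Fin 3 => ℝ) i) x := fun i => hasFDerivAt_apply i x
  have e0 := ((hc 0).add ((hc 2).mul (hU.mul ((hpd 0).const_mul h).neg))
    |>.congr_of_eventuallyEq (f₁ := fun z => Θh θ h z 0)
      (Eventually.of_forall fun z => by simp only [Θh_eq]; rfl)).fderiv
  have e1 := ((hc 1).add ((hc 2).mul (hU.mul ((hpd 1).const_mul h).neg))
    |>.congr_of_eventuallyEq (f₁ := fun z => Θh θ h z 1)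
      (Eventually.of_forall fun z => by simp only [Θh_eq]; rfl)).fderiv
  have e2 := ((hθ'.const_mul (h ^ 2)).add ((hc 2).mul hU)
    |>.congr_of_eventuallyEq (f₁ := fun z => Θh θ h z 2)
      (Eventually.of_forall fun z => by simp only [Θh_eq]; rfl)).fderiv
  have hb' : fderiv ℝ (pd 0 θ) y (Pi.single 1 1) = b := by
    rw [hb, pd2_comm hθ]; rfl
  have ha' : fderiv ℝ (pd 0 θ) y (Pi.single 0 1) = a := ha.symm
  have hb'' : fderiv ℝ (pd 1 θ) y (Pi.single 0 1) = b := hb.symm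
  have hd' : fderiv ℝ (pd 1 θ) y (Pi.single 1 1) = d := hd.symm
  have hp' : fderiv ℝ θ y (Pi.single 0 1) = p := hp.symm
  have hq' : fderiv ℝ θ y (Pi.single 1 1) = q := hq.symm
  simp only [Pi.neg_apply, Pi.mul_apply, hy', ← hp, ← hq, ← hu] at e0 e1 e2
  ext i j
  fin_cases i <;> fin_cases j <;>
    simp [jac3, e0, e1, e2, scaledProj_single_zero, scaledProj_single_one, scaledProj_single_two,
      ha', hb', hb'', hd', hp', hq', hr, hw] <;> field_simp <;> ring

lemma norm_mul_le_three_mul (A B : Matrix (Fin 3) (Fin 3) ℝ) : ‖A * B‖ ≤ 3 * ‖A‖ * ‖B‖ := by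
  rw [Matrix.norm_le_iff (by positivity)]
  intro i j
  rw [Matrix.mul_apply]
  refine (norm_sum_le_of_le (f := fun k => A i k * B k j) (n := fun _ => ‖A‖ * ‖B‖) _
    fun k _ => ?_).trans (by simp [mul_assoc])
  rw [norm_mul]
  exact mul_le_mul (A.norm_entry_le_entrywise_sup_norm) (B.norm_entry_le_entrywise_sup_norm)
    (norm_nonneg _) (norm_nonneg _)

lemma matrix_norm_smul_of_nonneg {c : ℝ} (hc : 0 ≤ c) (A : Matrix (Fin 3) (Fin 3) ℝ) :
    ‖c • A‖ = c * ‖A‖ := by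
  let _ := Matrix.normedSpace (R := ℝ) (m := Fin 3) (n := Fin 3) (α := ℝ)
  rw [norm_smul, Real.norm_of_nonneg hc]

lemma norm_one_fin_three : ‖(1 : Matrix (Fin 3) (Fin 3) ℝ)‖ ≤ 1 := by
  rw [Matrix.norm_le_iff zero_le_one]
  intro i j
  fin_cases i <;> fin_cases j <;> simp

/-- Sum of the principal `2 × 2` minors of a `3 × 3` matrix. -/
def principalMinorSum (G : Matrix (Fin 3) (Fin 3) ℝ) : ℝ :=
  G 0 0 * G 1 1 - G 0 1 * G 1 0 + (G 0 0 * G 2 2 - G 0 2 * G 2 0)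
    + (G 1 1 * G 2 2 - G 1 2 * G 2 1)

lemma det_one_sub_smul (G : Matrix (Fin 3) (Fin 3) ℝ) (h : ℝ) :
    (1 - h • G).det = 1 - h * G.trace + h ^ 2 * principalMinorSum G - h ^ 3 * G.det := by
  simp [Matrix.det_fin_three, Matrix.trace_fin_three, principalMinorSum]
  ring

lemma abs_trace_le {G : Matrix (Fin 3) (Fin 3) ℝ} {K : ℝ} (hG : ∀ i j, |G i j| ≤ K) :
    |G.trace| ≤ 3 * K := by
  rw [Matrix.trace_fin_three, abs_le]
  constructor <;>
    linarith [abs_le.1 (hG 0 0), abs_le.1 (hG 1 1), abs_le.1 (hG 2 2)]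

lemma abs_principalMinorSum_le {G : Matrix (Fin 3) (Fin 3) ℝ} {K : ℝ}
    (hG : ∀ i j, |G i j| ≤ K) : |principalMinorSum G| ≤ 6 * K ^ 2 := by
  have key : ∀ i j k l, |G i j * G k l| ≤ K ^ 2 := by
    intro i j k l
    rw [abs_mul, sq]
    exact mul_le_mul (hG _ _) (hG _ _) (abs_nonneg _) ((abs_nonneg _).trans (hG 0 0))
  rw [principalMinorSum, abs_le]
  have h1 := abs_le.1 (key 0 0 1 1)
  have h2 := abs_le.1 (key 0 1 1 0)
  have h3 := abs_le.1 (key 0 0 2 2)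
  have h4 := abs_le.1 (key 0 2 2 0)
  have h5 := abs_le.1 (key 1 1 2 2)
  have h6 := abs_le.1 (key 1 2 2 1)
  constructor <;> linarith

lemma abs_det_le {G : Matrix (Fin 3) (Fin 3) ℝ} {K : ℝ}
    (hG : ∀ i j, |G i j| ≤ K) : |G.det| ≤ 6 * K ^ 3 := by
  have := Matrix.det_le (A := G) (abv := AbsoluteValue.abs) (x := K) (by simpa using hG)
  simpa [Nat.factorial] using this

/-- If `A = h • C + h² • F` with `C` traceless and `h` small, then `1 - A` is invertible, its
determinant is `1 + O(h²)`, and its inverse is `1 + h C + h² (C² + F) + O(h³)`. -/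
lemma neumann_expansion {C F J : Matrix (Fin 3) (Fin 3) ℝ} {h K : ℝ} (hK : 1 ≤ K)
    (hh : 0 < h) (hsmall : h * (1000 * K ^ 3) ≤ 1) (hC : ‖C‖ ≤ K) (hF : ‖F‖ ≤ 2 * K)
    (htr : C.trace = 0) (hJ : J = 1 - (h • C + h ^ 2 • F)) :
    IsUnit J ∧ |J.det - 1| ≤ 1000 * K ^ 3 * h ^ 2 ∧ ‖J - 1‖ ≤ 1000 * K ^ 3 * h ∧
      ‖J⁻¹ - 1‖ ≤ 1000 * K ^ 3 * h ∧
      ‖J⁻¹ - (1 + h • C + h ^ 2 • (C * C + F))‖ ≤ 2000 * K ^ 3 * h ^ 3 := by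
  have hK2 : 1 ≤ K ^ 2 := one_le_pow₀ hK
  have hKK2 : K ≤ K ^ 2 := by nlinarith
  have hKK3 : K ^ 2 ≤ K ^ 3 := by nlinarith
  have hh1 : h ≤ 1 := by nlinarith
  set G := C + h • F with hGdef
  have hA : h • C + h ^ 2 • F = h • G := by
    rw [hGdef, smul_add, smul_smul, sq]
  rw [hA] at hJ
  have hG : ‖G‖ ≤ 3 * K := by
    refine (norm_add_le _ _).trans ?_
    rw [matrix_norm_smul_of_nonneg hh.le]
    nlinarith [norm_nonneg F]
  have hGe : ∀ i j, |G i j| ≤ 3 * K := fun i j =>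
    (G.norm_entry_le_entrywise_sup_norm (i := i) (j := j)).trans hG
  have hFe : ∀ i j, |F i j| ≤ 2 * K := fun i j =>
    (F.norm_entry_le_entrywise_sup_norm (i := i) (j := j)).trans hF
  have hdet : |J.det - 1| ≤ 1000 * K ^ 3 * h ^ 2 := by
    have h1 : J.det - 1 = h ^ 2 * (-F.trace + principalMinorSum G - h * G.det) := by
      rw [hJ, det_one_sub_smul, hGdef, Matrix.trace_add, Matrix.trace_smul, htr, smul_eq_mul]
      ring
    have t1 := abs_le.1 (abs_trace_le hFe)
    have t2 := abs_le.1 (abs_principalMinorSum_le hGe)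
    have t3 : |h * G.det| ≤ 6 * (3 * K) ^ 3 := by
      rw [abs_mul, abs_of_pos hh]
      nlinarith [abs_det_le hGe, abs_nonneg G.det]
    have t3' := abs_le.1 t3
    rw [h1, abs_mul, abs_of_pos (by positivity : (0 : ℝ) < h ^ 2), mul_comm]
    refine mul_le_mul_of_nonneg_right ?_ (by positivity)
    rw [abs_le]
    constructor <;> nlinarith
  have hunit : IsUnit J.det := by
    rw [isUnit_iff_ne_zero]
    intro h0
    rw [h0] at hdet
    have : h ≤ 1 / 1000 := by nlinarith
    norm_num at hdet
    nlinarith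
  have hnJ : ‖J - 1‖ ≤ 3 * K * h := by
    have : J - 1 = -(h • G) := by rw [hJ]; abel
    rw [this, norm_neg, matrix_norm_smul_of_nonneg hh.le]
    nlinarith
  have hnA : ‖h • G‖ ≤ 3 * K * h := by
    rw [matrix_norm_smul_of_nonneg hh.le]
    nlinarith
  set B := J⁻¹ with hB
  have hBJ : B = 1 + B * (h • G) := by
    have h1 : B * J = 1 := Matrix.nonsing_inv_mul _ hunit
    have h2 : B * (1 - h • G) = 1 := by rw [← hJ]; exact h1
    rw [mul_sub, mul_one] at h2
    exact sub_eq_iff_eq_add.1 h2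
  have hBA := norm_mul_le_three_mul B (h • G)
  have hBnorm : ‖B‖ ≤ 2 := by
    have h1 : ‖B‖ ≤ 1 + ‖B * (h • G)‖ := by
      calc ‖B‖ = ‖1 + B * (h • G)‖ := congrArg _ hBJ
        _ ≤ _ := (norm_add_le _ _).trans (by linarith [norm_one_fin_three])
    have h2 : 3 * ‖h • G‖ ≤ 1 / 2 := by nlinarith
    nlinarith [norm_nonneg B]
  have hBA' : ‖B * (h • G)‖ ≤ 18 * K * h := by
    nlinarith [norm_nonneg B, norm_nonneg (h • G)]
  refine ⟨(Matrix.isUnit_iff_isUnit_det _).2 hunit, hdet, ?_, ?_, ?_⟩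
  · nlinarith
  · have : B - 1 = B * (h • G) := sub_eq_iff_eq_add'.2 hBJ
    rw [this]
    nlinarith
  · have hexp : B = 1 + h • G + (h • G) * (h • G) + B * (h • G) * (h • G) * (h • G) := by
      have h1 := congrArg (· * (h • G)) hBJ
      have h2 := congrArg (· * (h • G)) h1
      simp only [add_mul, one_mul] at h1 h2
      calc B = 1 + B * (h • G) := hBJ
        _ = 1 + (h • G + B * (h • G) * (h • G)) := by rw [← h1]
        _ = 1 + (h • G + ((h • G) * (h • G) + B * (h • G) * (h • G) * (h • G))) := by rw [← h2]
        _ = _ := by abel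
    have hdiff : B - (1 + h • C + h ^ 2 • (C * C + F))
        = h ^ 3 • (C * F + F * G) + B * (h • G) * (h • G) * (h • G) := by
      conv_lhs => rw [hexp]
      rw [hGdef]
      simp only [smul_add, mul_add, add_mul, smul_mul_assoc, mul_smul_comm, smul_smul]
      module
    rw [hdiff]
    have n1 := norm_mul_le_three_mul C F
    have n2 := norm_mul_le_three_mul F G
    have n3 := norm_mul_le_three_mul (B * (h • G)) (h • G)
    have n4 := norm_mul_le_three_mul (B * (h • G) * (h • G)) (h • G)
    have m1 : ‖C * F‖ ≤ 6 * K ^ 2 := by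
      have := mul_le_mul hC hF (norm_nonneg _) (by linarith)
      nlinarith
    have m2 : ‖F * G‖ ≤ 18 * K ^ 2 := by
      have := mul_le_mul hF hG (norm_nonneg _) (by linarith)
      nlinarith
    have m3 : ‖B * (h • G) * (h • G)‖ ≤ 162 * K ^ 2 * h ^ 2 := by
      have := mul_le_mul hBA' hnA (norm_nonneg _) (by positivity)
      nlinarith
    have m4 : ‖B * (h • G) * (h • G) * (h • G)‖ ≤ 1458 * K ^ 3 * h ^ 3 := by
      have := mul_le_mul m3 hnA (norm_nonneg _) (by positivity)
      nlinarith
    refine (norm_add_le _ _).trans ?_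
    rw [matrix_norm_smul_of_nonneg (by positivity)]
    have m5 : ‖C * F + F * G‖ ≤ 24 * K ^ 3 := (norm_add_le _ _).trans (by linarith)
    have m6 := mul_le_mul_of_nonneg_left m5 (by positivity : (0 : ℝ) ≤ h ^ 3)
    have : 0 ≤ K ^ 3 * h ^ 3 := by positivity
    linarith

/-- First and second order estimates for `u = (1 + v)^{-1/2}`. -/
lemma inv_sqrt_one_add_estimates {v u : ℝ} (hv : 0 ≤ v) (hu : u = (√(v + 1))⁻¹) :
    0 < u ∧ u ≤ 1 ∧ 1 - u ≤ v / 2 ∧ |u - 1 + v / 2| ≤ v ^ 2 / 2 := by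
  set s := √(v + 1) with hs
  have hs2 : s ^ 2 = v + 1 := Real.sq_sqrt (by linarith)
  have hs1 : 1 ≤ s := Real.one_le_sqrt.2 (by linarith)
  have hus : u * s = 1 := by rw [hu]; exact inv_mul_cancel₀ (by linarith)
  have hu0 : 0 < u := by rw [hu]; positivity
  have hu1 : u ≤ 1 := by nlinarith
  have hv' : v = s ^ 2 - 1 := by linarith
  have e : 1 - u = u * (s - 1) := by linarith
  have h2 : u * (s - 1) ≤ s - 1 := by nlinarith
  refine ⟨hu0, hu1, by nlinarith, ?_⟩
  have e2 : u - 1 + v / 2 = (s - 1) ^ 2 * (u * (s + 2) / 2) := by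
    rw [hv']
    linear_combination (-(s ^ 2 - 3) / 2) * hus
  have e3 : u * (s + 2) / 2 ≤ 3 / 2 := by nlinarith
  rw [e2, abs_of_nonneg (by positivity), hv']
  have e4 : (s ^ 2 - 1) ^ 2 / 2 = (s - 1) ^ 2 * ((s + 1) ^ 2 / 2) := by ring
  rw [e4]
  exact mul_le_mul_of_nonneg_left (by nlinarith) (by positivity)

set_option maxHeartbeats 600000 in
/-- The remainder in the second order expansion of `∇Θʰ` is `O(h³)`, uniformly in `x`. -/
lemma jac3_Θh_remainder_le {θ : E 2 → ℝ} (hθ : ContDiff ℝ 2 θ) {M : ℝ} (hM : 1 ≤ M)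
    (hpd : ∀ i y, |pd i θ y| ≤ M) (hpd2 : ∀ i j y, |pd2 i j θ y| ≤ M)
    {h : ℝ} (hh : 0 < h) (hh1 : h ≤ 1) (x : E 3)
    (hx : x 2 ∈ Set.Icc (-(h ^ 2) / 2) (h ^ 2 / 2)) (i j : Fin 3) :
    |(jac3 (Θh θ h) x - (1 - h • Cmat θ h ![x 0, x 1]
      - h ^ 2 • Dmat θ h ![x 0, x 1] (x 2 / h ^ 2))) i j| ≤ 2 * M ^ 4 * h ^ 3 := by
  set y : E 2 := h⁻¹ • ![x 0, x 1] with hy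
  obtain ⟨p, hp⟩ : ∃ p, p = pd 0 θ y := ⟨_, rfl⟩
  obtain ⟨q, hq⟩ : ∃ q, q = pd 1 θ y := ⟨_, rfl⟩
  obtain ⟨a, ha⟩ : ∃ a, a = pd2 0 0 θ y := ⟨_, rfl⟩
  obtain ⟨b, hb⟩ : ∃ b, b = pd2 0 1 θ y := ⟨_, rfl⟩
  obtain ⟨d, hd⟩ : ∃ d, d = pd2 1 1 θ y := ⟨_, rfl⟩
  obtain ⟨u, hu⟩ : ∃ u, u = (√(h ^ 2 * p ^ 2 + h ^ 2 * q ^ 2 + 1))⁻¹ := ⟨_, rfl⟩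
  obtain ⟨r, hr⟩ : ∃ r, r = p * a + q * b := ⟨_, rfl⟩
  obtain ⟨w, hw⟩ : ∃ w, w = p * b + q * d := ⟨_, rfl⟩
  obtain ⟨t, ht⟩ : ∃ t, t = x 2 / h ^ 2 := ⟨_, rfl⟩
  have hx2 : x 2 = h ^ 2 * t := by rw [ht]; field_simp
  have hh2 : 0 < h ^ 2 := by positivity
  have htb : |t| ≤ 1 / 2 := by
    rw [hx2] at hx
    rw [abs_le]
    constructor <;> nlinarith [hx.1, hx.2]
  have bp : |p| ≤ M := hp ▸ hpd 0 y
  have bq : |q| ≤ M := hq ▸ hpd 1 y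
  have ba : |a| ≤ M := ha ▸ hpd2 0 0 y
  have bb : |b| ≤ M := hb ▸ hpd2 0 1 y
  have bd : |d| ≤ M := hd ▸ hpd2 1 1 y
  have hM2 : 1 ≤ M ^ 2 := one_le_pow₀ hM
  have hM23 : M ^ 2 ≤ M ^ 3 := pow_le_pow_right₀ hM (by norm_num)
  have hM34 : M ^ 3 ≤ M ^ 4 := pow_le_pow_right₀ hM (by norm_num)
  have hmul : ∀ {α β A B : ℝ}, |α| ≤ A → |β| ≤ B → |α * β| ≤ A * B := by
    intro α β A B h1 h2
    rw [abs_mul]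
    exact mul_le_mul h1 h2 (abs_nonneg _) ((abs_nonneg _).trans h1)
  have br : |r| ≤ 2 * M ^ 2 := by
    rw [hr]
    exact (abs_add_le _ _).trans (by linarith [hmul bp ba, hmul bq bb])
  have bw : |w| ≤ 2 * M ^ 2 := by
    rw [hw]
    exact (abs_add_le _ _).trans (by linarith [hmul bp bb, hmul bq bd])
  have bp2 : p ^ 2 ≤ M ^ 2 := sq_le_sq' (abs_le.1 bp).1 (abs_le.1 bp).2
  have bq2 : q ^ 2 ≤ M ^ 2 := sq_le_sq' (abs_le.1 bq).1 (abs_le.1 bq).2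
  obtain ⟨hu0, hu1, hu2, hu3⟩ := inv_sqrt_one_add_estimates
    (v := h ^ 2 * p ^ 2 + h ^ 2 * q ^ 2) (by positivity) hu
  have hvle : h ^ 2 * p ^ 2 + h ^ 2 * q ^ 2 ≤ 2 * M ^ 2 * h ^ 2 := by nlinarith
  have bu : |1 - u| ≤ M ^ 2 * h ^ 2 := by
    rw [abs_of_nonneg (by linarith)]
    linarith
  have bu3 : |u ^ 3| ≤ 1 := by
    rw [abs_of_pos (by positivity)]
    exact pow_le_one₀ hu0.le hu1
  have bh : |h| ≤ h := (abs_of_pos hh).le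
  have bh2 : |h ^ 2| ≤ h ^ 2 := (abs_of_pos hh2).le
  have h43 : h ^ 4 ≤ h ^ 3 := pow_le_pow_of_le_one hh.le hh1 (by norm_num)
  have block : ∀ {m c g : ℝ}, |m| ≤ M → |c| ≤ M → |g| ≤ 2 * M ^ 2 →
      |h ^ 2 * t * (m * (1 - u) + h ^ 2 * (c * g * u ^ 3))| ≤ 2 * M ^ 4 * h ^ 3 := by
    intro m c g bm bc bg
    have h1 := hmul bm bu
    have h2 := hmul bh2 (hmul (hmul bc bg) bu3)
    have h3 := (abs_add_le _ _).trans (add_le_add h1 h2)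
    refine (hmul (hmul bh2 htb) h3).trans ?_
    calc h ^ 2 * (1 / 2) * (M * (M ^ 2 * h ^ 2) + h ^ 2 * (M * (2 * M ^ 2) * 1))
        = 3 / 2 * (M ^ 3 * h ^ 4) := by ring
      _ ≤ 3 / 2 * (M ^ 4 * h ^ 3) := by gcongr
      _ ≤ 2 * M ^ 4 * h ^ 3 := by linarith [show 0 ≤ M ^ 4 * h ^ 3 by positivity]
  have side : ∀ {c : ℝ}, |c| ≤ M → |h * (c * (1 - u))| ≤ 2 * M ^ 4 * h ^ 3 := by
    intro c bc
    refine (hmul bh (hmul bc bu)).trans ?_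
    calc h * (M * (M ^ 2 * h ^ 2)) = M ^ 3 * h ^ 3 := by ring
      _ ≤ 2 * M ^ 4 * h ^ 3 := by gcongr; linarith [show 0 ≤ M ^ 4 by positivity]
  have bottom : ∀ {g : ℝ}, |g| ≤ 2 * M ^ 2 →
      |h ^ 2 * t * (h * (g * u ^ 3))| ≤ 2 * M ^ 4 * h ^ 3 := by
    intro g bg
    refine (hmul (hmul bh2 htb) (hmul bh (hmul bg bu3))).trans ?_
    calc h ^ 2 * (1 / 2) * (h * (2 * M ^ 2 * 1)) = M ^ 2 * h ^ 3 := by ring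
      _ ≤ 2 * M ^ 4 * h ^ 3 := by gcongr; linarith [show 0 ≤ M ^ 4 by positivity]
  have corner : |u - 1 + (h ^ 2 * p ^ 2 + h ^ 2 * q ^ 2) / 2| ≤ 2 * M ^ 4 * h ^ 3 := by
    refine hu3.trans ?_
    calc (h ^ 2 * p ^ 2 + h ^ 2 * q ^ 2) ^ 2 / 2 ≤ (2 * M ^ 2 * h ^ 2) ^ 2 / 2 := by gcongr
      _ = 2 * M ^ 4 * h ^ 4 := by ring
      _ ≤ _ := by gcongr
  rw [jac3_Θh hθ hh.ne' x hy hp hq ha hb hd hu hr hw, Cmat, Dmat, ← hy, ← hp, ← hq, ← ha, ← hb,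
    ← hd, ← ht, hx2]
  fin_cases i <;> fin_cases j
  · convert block ba bp br using 2
    simp; ring
  · convert block bb bp bw using 2
    simp; ring
  · convert side bp using 2
    simp; ring
  · convert block bb bq br using 2
    simp; ring
  · convert block bd bq bw using 2
    simp; ring
  · convert side bq using 2
    simp; ring
  · rw [← abs_neg]
    convert bottom br using 2
    simp; ring
  · rw [← abs_neg]
    convert bottom bw using 2
    simp; ring
  · convert corner using 2
    simp; ring

/-- **Theorem 1** (expansion of the Jacobian of the wrinkled-plate parametrization).
For a `[0,1]²`-periodic shape function `θ` of class `C²` there are `h₀ > 0` and `C₀ > 0`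
such that for all `0 < h ≤ h₀` and all `x` in `Ω̄^h = ω̄ × [−h²/2, h²/2]` the Jacobian of `Θ^h`
is invertible and admits the asymptotic expansions (2.2)–(2.5). -/
theorem theorem1_jacobian_expansion
    (ω : Set (E 2)) (hω : IsOpen ω) (hbd : Bornology.IsBounded ω) (hne : ω.Nonempty)
    (θ : E 2 → ℝ) (hθ : ContDiff ℝ 2 θ) (hper : YPeriodic θ) :
    ∃ h₀ > (0 : ℝ), ∃ C₀ > (0 : ℝ),
      ∃ δ : ℝ → E 3 → ℝ,
      ∃ R₁ R₂ : ℝ → E 3 → Matrix (Fin 3) (Fin 3) ℝ,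
        ∀ h : ℝ, 0 < h → h ≤ h₀ →
          ∀ x : E 3, ![x 0, x 1] ∈ closure ω → x 2 ∈ Set.Icc (-(h ^ 2) / 2) (h ^ 2 / 2) →
            -- invertibility of the Jacobian matrix
            IsUnit (jac3 (Θh θ h) x) ∧
            -- (2.2): det ∇Θ^h = 1 + h² δ^h with δ^h uniformly bounded
            (jac3 (Θh θ h) x).det = 1 + h ^ 2 * δ h x ∧ |δ h x| ≤ C₀ ∧
            -- (2.3): ∇Θ^h = I − hC − h²D + h³R₁^h
            jac3 (Θh θ h) x =
              1 - h • Cmat θ h ![x 0, x 1] - h ^ 2 • Dmat θ h ![x 0, x 1] (x 2 / h ^ 2)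
                + h ^ 3 • R₁ h x ∧
            -- (2.4): (∇Θ^h)⁻¹ = I + hC + h²E + h³R₂^h
            (jac3 (Θh θ h) x)⁻¹ =
              1 + h • Cmat θ h ![x 0, x 1] + h ^ 2 • Emat θ h ![x 0, x 1] (x 2 / h ^ 2)
                + h ^ 3 • R₂ h x ∧
            -- uniform bounds on the remainders
            (∀ i j : Fin 3, |R₁ h x i j| ≤ C₀) ∧ (∀ i j : Fin 3, |R₂ h x i j| ≤ C₀) ∧
            -- (2.5): ‖∇Θ^h − I‖_{L∞}, ‖(∇Θ^h)⁻¹ − I‖_{L∞} ≤ C₀ h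
            ‖jac3 (Θh θ h) x - 1‖ ≤ C₀ * h ∧ ‖(jac3 (Θh θ h) x)⁻¹ - 1‖ ≤ C₀ * h := by
  obtain ⟨M, hM, hpd, hpd2⟩ : ∃ M : ℝ, 1 ≤ M ∧ (∀ i y, |pd i θ y| ≤ M) ∧
      ∀ i j y, |pd2 i j θ y| ≤ M := by
    have c1 : ∀ i, ContDiff ℝ 1 (pd i θ) := fun i => hθ.pd (by norm_num) i
    have c2 : ∀ i j, ContDiff ℝ 0 (pd2 i j θ) := fun i j => (c1 j).pd (by norm_num) i
    choose A hA using fun i => (hper.pd i).exists_bound (c1 i).continuous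
    choose B hB using fun i j => ((hper.pd j).pd i).exists_bound (c2 i j).continuous
    refine ⟨1 + ∑ i, |A i| + ∑ i, ∑ j, |B i j|, ?_, fun i y => ?_, fun i j y => ?_⟩
    · have : 0 ≤ ∑ i, |A i| + ∑ i, ∑ j, |B i j| := by positivity
      linarith
    · have h1 := Finset.single_le_sum (f := fun i => |A i|) (fun i _ => abs_nonneg _)
        (Finset.mem_univ i)
      have h2 : 0 ≤ ∑ i, ∑ j, |B i j| := by positivity
      linarith [hA i y, le_abs_self (A i)]
    · have h1 := Finset.single_le_sum (f := fun j => |B i j|) (fun i _ => abs_nonneg _)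
        (Finset.mem_univ j)
      have h2 := Finset.single_le_sum (f := fun i => ∑ j, |B i j|)
        (fun i _ => Finset.sum_nonneg fun j _ => abs_nonneg _) (Finset.mem_univ i)
      have h3 : 0 ≤ ∑ i, |A i| := by positivity
      have h4 : |pd2 i j θ y| ≤ B i j := hB i j y
      linarith [le_abs_self (B i j)]
  obtain ⟨K, hKdef⟩ : ∃ K, K = 2 * M ^ 4 := ⟨_, rfl⟩
  have hM24 : M ^ 2 ≤ M ^ 4 := pow_le_pow_right₀ hM (by norm_num)
  have hM12 : M ≤ M ^ 2 := by nlinarith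
  have hK : 1 ≤ K := by linarith
  have hK3 : K ≤ K ^ 3 := le_self_pow₀ hK (by norm_num)
  refine ⟨1 / (1000 * K ^ 3), by positivity, 3000 * K ^ 3, by positivity,
    fun h x => ((jac3 (Θh θ h) x).det - 1) / h ^ 2,
    fun h x => (h ^ 3)⁻¹ • (jac3 (Θh θ h) x - (1 - h • Cmat θ h ![x 0, x 1]
      - h ^ 2 • Dmat θ h ![x 0, x 1] (x 2 / h ^ 2))),
    fun h x => (h ^ 3)⁻¹ • ((jac3 (Θh θ h) x)⁻¹ - (1 + h • Cmat θ h ![x 0, x 1]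
      + h ^ 2 • Emat θ h ![x 0, x 1] (x 2 / h ^ 2))), ?_⟩
  intro h hh hh0 x _ hx
  have hsmall : h * (1000 * K ^ 3) ≤ 1 := (le_div_iff₀ (by positivity)).1 hh0
  have hh1 : h ≤ 1 := by nlinarith
  have hh2 : 0 < h ^ 2 := by positivity
  have hh3 : 0 < h ^ 3 := by positivity
  have hrem := jac3_Θh_remainder_le hθ hM hpd hpd2 hh hh1 x hx
  have htb : |x 2 / h ^ 2| ≤ 1 / 2 := by
    rw [abs_div, abs_of_pos hh2, div_le_iff₀ hh2, abs_le]
    constructor <;> linarith [hx.1, hx.2]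
  have hCn : ‖Cmat θ h ![x 0, x 1]‖ ≤ K := by
    rw [Matrix.norm_le_iff (by linarith)]
    intro i j
    have h0 := hpd 0 (h⁻¹ • ![x 0, x 1])
    have h1 := hpd 1 (h⁻¹ • ![x 0, x 1])
    fin_cases i <;> fin_cases j <;> simp [Cmat] at h0 h1 ⊢ <;> linarith
  have hDn : ‖Dmat θ h ![x 0, x 1] (x 2 / h ^ 2)‖ ≤ K := by
    rw [Matrix.norm_le_iff (by linarith)]
    generalize x 2 / h ^ 2 = t at htb
    generalize hy : h⁻¹ • ![x 0, x 1] = y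
    have h0 : ∀ i j, |t * pd2 i j θ y| ≤ K := by
      intro i j
      rw [abs_mul]
      have := mul_le_mul htb (hpd2 i j y) (abs_nonneg _) (by norm_num)
      linarith
    have h1 : ∀ i, pd i θ y ^ 2 ≤ M ^ 2 := fun i =>
      sq_le_sq' (abs_le.1 (hpd i y)).1 (abs_le.1 (hpd i y)).2
    have h2 : |1 / 2 * (pd 0 θ y ^ 2 + pd 1 θ y ^ 2)| ≤ K := by
      rw [abs_of_nonneg (by positivity)]
      linarith [h1 0, h1 1]
    have hK0 : |(0 : ℝ)| ≤ K := by rw [abs_zero]; linarith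
    intro i j
    rw [Dmat, hy, Real.norm_eq_abs]
    fin_cases i <;> fin_cases j
    exacts [h0 0 0, h0 0 1, hK0, h0 0 1, h0 1 1, hK0, hK0, hK0, h2]
  have htr : (Cmat θ h ![x 0, x 1]).trace = 0 := by simp [Matrix.trace_fin_three, Cmat]
  have hE : Emat θ h ![x 0, x 1] (x 2 / h ^ 2) = Cmat θ h ![x 0, x 1] * Cmat θ h ![x 0, x 1]
      + Dmat θ h ![x 0, x 1] (x 2 / h ^ 2) := rfl
  simp only [hE]
  generalize Cmat θ h ![x 0, x 1] = C at *
  generalize Dmat θ h ![x 0, x 1] (x 2 / h ^ 2) = D at *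
  generalize jac3 (Θh θ h) x = J at *
  obtain ⟨R, hR⟩ : ∃ R, R = (h ^ 3)⁻¹ • (J - (1 - h • C - h ^ 2 • D)) := ⟨_, rfl⟩
  have hJR : J = 1 - h • C - h ^ 2 • D + h ^ 3 • R := by
    rw [hR, smul_inv_smul₀ hh3.ne']
    abel
  have hRe : ∀ i j, |R i j| ≤ K := by
    intro i j
    rw [hR, Matrix.smul_apply, smul_eq_mul, abs_mul, abs_of_pos (inv_pos.2 hh3),
      inv_mul_le_iff₀ hh3, hKdef, mul_comm (h ^ 3)]
    exact hrem i j
  have hRn : ‖R‖ ≤ K := (Matrix.norm_le_iff (by linarith)).2 hRe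
  have hFn : ‖D - h • R‖ ≤ 2 * K := by
    refine (norm_sub_le _ _).trans ?_
    rw [matrix_norm_smul_of_nonneg hh.le]
    nlinarith [norm_nonneg R]
  obtain ⟨hunit, hdet, hn1, hn2, hn3⟩ := neumann_expansion hK hh hsmall hCn hFn htr
    (J := J) (by rw [hJR]; module)
  rw [← hR]
  refine ⟨hunit, ?_, ?_, hJR, ?_, fun i j => (hRe i j).trans (by nlinarith), fun i j => ?_,
    hn1.trans (by gcongr; norm_num), hn2.trans (by gcongr; norm_num)⟩
  · field_simp
    ring
  · rw [abs_div, abs_of_pos hh2, div_le_iff₀ hh2]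
    exact hdet.trans (by gcongr; norm_num)
  · rw [smul_inv_smul₀ hh3.ne']
    abel
  · rw [Matrix.smul_apply, smul_eq_mul, abs_mul, abs_of_pos (inv_pos.2 hh3), inv_mul_le_iff₀ hh3,
      ← Real.norm_eq_abs]
    refine (Matrix.norm_entry_le_entrywise_sup_norm _).trans ?_
    have e : J⁻¹ - (1 + h • C + h ^ 2 • (C * C + D))
        = J⁻¹ - (1 + h • C + h ^ 2 • (C * C + (D - h • R))) - h ^ 3 • R := by
      module
    rw [e]
    refine (norm_sub_le _ _).trans ?_
    rw [matrix_norm_smul_of_nonneg hh3.le]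
    nlinarith [mul_le_mul_of_nonneg_left (hRn.trans hK3) hh3.le,
      mul_pos hh3 (by positivity : 0 < K ^ 3)]

end
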